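/- Let R be a commutative noetherian domain over a field k, B = R_p(t,sigma,H,J) a BR algebra of rank n, Gamma the subgroup of Aut(R) generated by sigma_1,...,sigma_n, and X = ({a t^alpha : a in I^{(alpha)}, alpha > 0} union {1}) minus {0}, where alpha > 0 means alpha_i >= 0 for all i and alpha != 0. Then B is a simple ring if and only if the following three conditions hold: (1) B x B = B for all x in X; (2) R is Gamma-simple, i.e. the only ideals I of R with sigma(I) = I for all sigma in Gamma are I = 0 and I = R; and (3) the center Z(B) is contained in R. -/

import Mathlib

open scoped Pointwise TensorProduct

namespace BR

/-- The ordered product `t₁^{α₁} ⋯ tₙ^{αₙ}` in the group of units. -/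
def tpow {A : Type*} [Monoid A] {n : ℕ} (t : Fin n → Aˣ) (α : Fin n → ℤ) : Aˣ :=
  ((List.finRange n).map fun i => t i ^ α i).prod

/-- `σ^α = σ₁^{α₁} ⋯ σₙ^{αₙ}` as an algebra automorphism. -/
def σpow {k R : Type*} [CommSemiring k] [Semiring R] [Algebra k R] {n : ℕ}
    (σ : Fin n → R ≃ₐ[k] R) (α : Fin n → ℤ) : R ≃ₐ[k] R :=
  ((List.finRange n).map fun i => σ i ^ α i).prod

/-- The ideal `I_σ^{(m)}(H, J)`:  `J σ(J) ⋯ σ^{m-1}(J)` for `m > 0`, `R` for `m = 0`,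
and `σ⁻¹(H) σ⁻²(H) ⋯ σ^{m}(H)` for `m < 0`. -/
noncomputable def seg {k R : Type*} [Field k] [Ring R] [Algebra k R]
    (σ : R ≃ₐ[k] R) (H J : Submodule k R) (m : ℤ) : Submodule k R :=
  if 0 < m then
    ((List.range m.toNat).map fun i => J.map (σ ^ (i : ℤ)).toLinearMap).prod
  else if m = 0 then ⊤
  else ((List.range (-m).toNat).map fun i => H.map (σ ^ (-((i : ℤ) + 1))).toLinearMap).prod

/-- `I^{(α)} = I₁^{(α₁)} ⋯ Iₙ^{(αₙ)}`. -/
noncomputable def segVec {k R : Type*} [Field k] [Ring R] [Algebra k R] {n : ℕ}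
    (σ : Fin n → R ≃ₐ[k] R) (H J : Fin n → Submodule k R) (α : Fin n → ℤ) :
    Submodule k R :=
  ((List.finRange n).map fun i => seg (σ i) (H i) (J i) (α i)).prod

/-- A Bell–Rogalski datum `(R, t, σ, p, H, J)`. -/
structure IsBRDatum {k R : Type*} [Field k] [Ring R] [Algebra k R] {n : ℕ}
    (σ : Fin n → R ≃ₐ[k] R) (p : Fin n → Fin n → kˣ)
    (H J : Fin n → Submodule k R) : Prop where
  comm : ∀ i j, σ i * σ j = σ j * σ i
  antisym : ∀ i j, p i j = (p j i)⁻¹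
  H_mul_left : ∀ i (r x : R), x ∈ H i → r * x ∈ H i
  H_mul_right : ∀ i (r x : R), x ∈ H i → x * r ∈ H i
  J_mul_left : ∀ i (r x : R), x ∈ J i → r * x ∈ J i
  J_mul_right : ∀ i (r x : R), x ∈ J i → x * r ∈ J i
  mapH : ∀ i j, i ≠ j → (H j).map (σ i).toLinearMap = H j
  mapJ : ∀ i j, i ≠ j → (J j).map (σ i).toLinearMap = J j
  HH : ∀ i j, i ≠ j → H i * H j = H j * H i
  HJ : ∀ i j, i ≠ j → H i * J j = J j * H i
  JJ : ∀ i j, i ≠ j → J i * J j = J j * J i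
  seg_ne_bot : ∀ i (m : ℤ), seg (σ i) (H i) (J i) m ≠ ⊥

/-- A realization of the iterated skew Laurent extension `R_p[t^{±1}; σ]`:
an algebra `A` containing `R`, with units `t i` satisfying the skew commutation
relations, which is a free left `R`-module with basis the monomials `t^α`. -/
structure SkewLaurent (k : Type*) [Field k] {R : Type*} [Ring R] [Algebra k R] {n : ℕ}
    (σ : Fin n → R ≃ₐ[k] R) (p : Fin n → Fin n → kˣ)
    (A : Type*) [Ring A] [Algebra k A] where
  ι : R →ₐ[k] A
  t : Fin n → Aˣ
  rel_r : ∀ i (r : R), (t i : A) * ι r = ι (σ i r) * (t i : A)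
  rel_t : ∀ i j, i ≠ j → (t j : A) * (t i : A) =
    algebraMap k A (p i j) * ((t i : A) * (t j : A))
  repr_exists : ∀ a : A, ∃ c : (Fin n → ℤ) →₀ R,
    a = c.sum fun α r => ι r * (tpow t α : A)
  repr_free : ∀ c : (Fin n → ℤ) →₀ R,
    (c.sum fun α r => ι r * (tpow t α : A)) = 0 → c = 0

/-- The graded component `B_α = I^{(α)} t^α` of the Bell–Rogalski algebra, as a
`k`-subspace of the ambient skew Laurent extension. -/
noncomputable def brComponent {k R : Type*} [Field k] [Ring R] [Algebra k R] {n : ℕ}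
    {σ : Fin n → R ≃ₐ[k] R} {p : Fin n → Fin n → kˣ}
    {A : Type*} [Ring A] [Algebra k A]
    (E : SkewLaurent k σ p A) (H J : Fin n → Submodule k R) (α : Fin n → ℤ) :
    Submodule k A :=
  ((segVec σ H J α).map E.ι.toLinearMap).map (LinearMap.mulRight k ((tpow E.t α : Aˣ) : A))

/-- The Bell–Rogalski algebra `B = ⊕_α I^{(α)} t^α` as a `k`-subspace of the
ambient skew Laurent extension. -/
noncomputable def brSubmodule {k R : Type*} [Field k] [Ring R] [Algebra k R] {n : ℕ}
    {σ : Fin n → R ≃ₐ[k] R} {p : Fin n → Fin n → kˣ}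
    {A : Type*} [Ring A] [Algebra k A]
    (E : SkewLaurent k σ p A) (H J : Fin n → Submodule k R) : Submodule k A :=
  ⨆ α : Fin n → ℤ, brComponent E H J α

/-- The weight space `M_𝔪 = {v ∈ M ∣ 𝔪 ⬝ v = 0}` of a module over an algebra `B`
receiving a map from `R`. -/
def weightSpace {k R B : Type*} [Field k] [CommRing R] [Algebra k R]
    [Ring B] [Algebra k B] (ιB : R →ₐ[k] B)
    (M : Type*) [AddCommGroup M] [Module B M] (m : Ideal R) : AddSubgroup M where
  carrier := {v | ∀ r ∈ m, ιB r • v = 0}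
  zero_mem' := by intro r hr; simp
  add_mem' := by intro a b ha hb r hr; rw [smul_add, ha r hr, hb r hr, add_zero]
  neg_mem' := by intro a ha r hr; rw [smul_neg, ha r hr, neg_zero]

/-- `M` is a weight module: the direct sum of its weight spaces over maximal ideals. -/
def IsWeightModule {k R B : Type*} [Field k] [CommRing R] [Algebra k R]
    [Ring B] [Algebra k B] (ιB : R →ₐ[k] B)
    (M : Type*) [AddCommGroup M] [Module B M] : Prop :=
  (⨆ m : MaximalSpectrum R, weightSpace ιB M m.asIdeal) = ⊤ ∧
    iSupIndep fun m : MaximalSpectrum R => weightSpace ιB M m.asIdeal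

/-- A bundled simple weight module over `B`. -/
structure SimpleWeightWitness.{w, uk, uR, uB} (k : Type uk) [Field k] {R : Type uR}
    [CommRing R] [Algebra k R]
    (B : Type uB) [Ring B] [Algebra k B] (ιB : R →ₐ[k] B) where
  M : Type w
  [acg : AddCommGroup M]
  [mod : Module B M]
  simple : IsSimpleModule B M
  weight : IsWeightModule ιB M

attribute [instance] SimpleWeightWitness.acg SimpleWeightWitness.mod

/-- The support of a bundled weight module. -/
def SimpleWeightWitness.supp {k : Type*} [Field k] {R : Type*} [CommRing R] [Algebra k R]
    {B : Type*} [Ring B] [Algebra k B] {ιB : R →ₐ[k] B}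
    (W : SimpleWeightWitness k B ιB) : Set (MaximalSpectrum R) :=
  {m' | weightSpace ιB W.M m'.asIdeal ≠ ⊥}

/-- Isomorphism of bundled weight modules, as `B`-modules. -/
def SimpleWeightWitness.Iso {k : Type*} [Field k] {R : Type*} [CommRing R] [Algebra k R]
    {B : Type*} [Ring B] [Algebra k B] {ιB : R →ₐ[k] B}
    (W : SimpleWeightWitness k B ιB) (W' : SimpleWeightWitness k B ιB) : Prop :=
  Nonempty (W.M ≃ₗ[B] W'.M)

/-- Gelfand–Kirillov dimension of a `k`-algebra. -/
noncomputable def GKdim (k A : Type*) [Field k] [Ring A] [Algebra k A] : ENNReal :=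
  ⨆ S : Finset A, Filter.limsup
    (fun n : ℕ => ENNReal.ofReal (Real.logb n
      (Module.finrank k ↥((Submodule.span k (insert (1 : A) (S : Set A))) ^ n))))
    Filter.atTop

/-- An automorphism is locally algebraic if every orbit is contained in a
finite-dimensional subspace. -/
def LocallyAlgebraic {k R : Type*} [Field k] [Ring R] [Algebra k R]
    (σ : R ≃ₐ[k] R) : Prop :=
  ∀ r : R, ∃ V : Submodule k R, FiniteDimensional k ↥V ∧ ∀ m : ℕ, (σ ^ m) r ∈ V

/-- The defining relations of a twisted generalized Weyl algebra of type `(A₁)ⁿ`. -/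
def TGWARels (k : Type*) [Field k] {R : Type*} [Ring R] [Algebra k R] {n : ℕ}
    (σ : Fin n → R ≃ₐ[k] R) (a : Fin n → R) (γ μ : Fin n → Fin n → kˣ)
    {T : Type*} [Ring T] [Algebra k T]
    (ι : R →ₐ[k] T) (Xp Xm : Fin n → T) : Prop :=
  (∀ i (r : R), Xp i * ι r = ι (σ i r) * Xp i) ∧
  (∀ i (r : R), Xm i * ι r = ι ((σ i)⁻¹ r) * Xm i) ∧
  (∀ i, Xm i * Xp i = ι (a i)) ∧
  (∀ i, Xp i * Xm i = ι (σ i (a i))) ∧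
  (∀ i j, i ≠ j → Xp i * Xm j = ((μ i j : kˣ) : k) • (Xm j * Xp i)) ∧
  (∀ i j, i ≠ j → Xp i * Xp j = ((γ i j * (μ i j)⁻¹ : kˣ) : k) • (Xp j * Xp i)) ∧
  (∀ i j, i ≠ j → Xm j * Xm i = ((γ i j * (μ j i)⁻¹ : kˣ) : k) • (Xm i * Xm j))

/-- A realization of the twisted generalized Weyl algebra `A_μ(R, σ, a)` of type
`(A₁)ⁿ`: it satisfies the defining relations, is `ℤⁿ`-graded with `deg Xᵢ± = ±eᵢ`,
and is universal with respect to the relations. -/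
structure TGWA (k : Type*) [Field k] {R : Type*} [Ring R] [Algebra k R] {n : ℕ}
    (σ : Fin n → R ≃ₐ[k] R) (a : Fin n → R) (γ μ : Fin n → Fin n → kˣ)
    (T : Type*) [Ring T] [Algebra k T] where
  ι : R →ₐ[k] T
  Xp : Fin n → T
  Xm : Fin n → T
  rels : TGWARels k σ a γ μ ι Xp Xm
  grading : (Fin n → ℤ) → Submodule k T
  grading_internal : DirectSum.IsInternal grading
  grading_mul : ∀ (α β : Fin n → ℤ) (x y : T),
    x ∈ grading α → y ∈ grading β → x * y ∈ grading (α + β)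
  ι_mem : ∀ r, ι r ∈ grading 0
  Xp_mem : ∀ i, Xp i ∈ grading (Pi.single i 1)
  Xm_mem : ∀ i, Xm i ∈ grading (-Pi.single i 1)
  free : ∀ {C : Type} [Ring C] [Algebra k C] (ιC : R →ₐ[k] C) (Yp Ym : Fin n → C),
    TGWARels k σ a γ μ ιC Yp Ym →
    ∃! f : T →ₐ[k] C, f.comp ι = ιC ∧ (∀ i, f (Xp i) = Yp i) ∧ (∀ i, f (Xm i) = Ym i)


/-- The multiplicative set `X = ({a t^α ∣ a ∈ I^{(α)}, α > 0} ∪ {1}) \ {0}` of the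
BR algebra `B`, where `α > 0` means `αᵢ ≥ 0` for all `i` and `α ≠ 0`. -/
def oreSet {k R : Type*} [Field k] [Ring R] [Algebra k R] {n : ℕ}
    {σ : Fin n → R ≃ₐ[k] R} {p : Fin n → Fin n → kˣ}
    {A : Type*} [Ring A] [Algebra k A]
    (E : SkewLaurent k σ p A) (H J : Fin n → Submodule k R)
    (B : Subalgebra k A) : Set ↥B :=
  {x : ↥B | x ≠ 0 ∧ (x = 1 ∨ ∃ α : Fin n → ℤ, (∀ i, 0 ≤ α i) ∧ α ≠ 0 ∧
    ∃ a ∈ segVec σ H J α, (x : A) = E.ι a * (tpow E.t α : A))}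

section lists

theorem list_prod_zpow_add {G ι : Type*} [Group G] (x : ι → G)
    (hx : ∀ i j, Commute (x i) (x j)) (α β : ι → ℤ) (l : List ι) :
    (l.map fun i => x i ^ (α + β) i).prod =
      (l.map fun i => x i ^ α i).prod * (l.map fun i => x i ^ β i).prod := by
  induction l with
  | nil => simp
  | cons a l ih =>
    have hc : Commute ((l.map fun i => x i ^ α i).prod) (x a ^ β a) := by
      apply Commute.list_prod_left
      intro y hy
      obtain ⟨j, _, rfl⟩ := List.mem_map.1 hy
      exact ((hx j a).zpow_left _).zpow_right _
    rw [List.map_cons, List.prod_cons, ih, List.map_cons, List.prod_cons, List.map_cons,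
      List.prod_cons, Pi.add_apply, zpow_add]
    rw [mul_assoc, mul_assoc, ← mul_assoc (x a ^ β a), ← hc.eq, mul_assoc]

theorem list_prod_one {M ι : Type*} [Monoid M] (f : ι → M) (l : List ι)
    (h : ∀ i ∈ l, f i = 1) : (l.map f).prod = 1 := by
  induction l with
  | nil => simp
  | cons a l ih =>
    rw [List.map_cons, List.prod_cons, h a (by simp), ih (fun i hi => h i (by simp [hi])), one_mul]

theorem list_prod_single {M ι : Type*} [Monoid M] (f : ι → M) (i : ι) (l : List ι)
    (hl : l.Nodup) (hi : i ∈ l) (h : ∀ j, j ≠ i → f j = 1) : (l.map f).prod = f i := by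
  induction l with
  | nil => simp at hi
  | cons a l ih =>
    rw [List.nodup_cons] at hl
    rw [List.map_cons, List.prod_cons]
    by_cases ha : a = i
    · subst ha
      rw [list_prod_one f l, mul_one]
      intro j hj
      exact h j (fun e => hl.1 (e ▸ hj))
    · rw [h a ha, one_mul]
      exact ih hl.2 (by simpa [Ne.symm ha] using hi)

variable {k R : Type*} [Field k] [CommRing R] [Algebra k R]

theorem list_prod_ne_bot [IsDomain R] (l : List (Submodule k R)) (h : ∀ M ∈ l, M ≠ ⊥) :
    ∃ x ∈ l.prod, x ≠ 0 := by
  induction l with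
  | nil => exact ⟨1, by simp [Submodule.one_le.1 le_rfl], one_ne_zero⟩
  | cons M l ih =>
    obtain ⟨x, hx, hx0⟩ := ih (fun N hN => h N (by simp [hN]))
    obtain ⟨y, hy, hy0⟩ := Submodule.exists_mem_ne_zero_of_ne_bot (h M (by simp))
    exact ⟨y * x, by rw [List.prod_cons]; exact Submodule.mul_mem_mul hy hx, mul_ne_zero hy0 hx0⟩

theorem one_mem_list_prod (l : List (Submodule k R)) (h : ∀ M ∈ l, (1 : R) ∈ M) :
    (1 : R) ∈ l.prod := by
  induction l with
  | nil => simp [Submodule.one_le.1 le_rfl]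
  | cons M l ih =>
    rw [List.prod_cons, ← one_mul (1 : R)]
    exact Submodule.mul_mem_mul (h M (by simp)) (ih (fun N hN => h N (by simp [hN])))

theorem list_prod_le (l : List (Submodule k R))
    (h : ∀ M ∈ l, ∀ r x : R, x ∈ M → r * x ∈ M) : ∀ M ∈ l, l.prod ≤ M := by
  induction l with
  | nil => simp
  | cons N l ih =>
    intro M hM
    rw [List.prod_cons, Submodule.mul_le]
    intro a ha b hb
    rcases List.mem_cons.1 hM with rfl | hM'
    · rw [mul_comm]; exact h M (by simp) _ _ ha
    · exact h M hM _ _ (ih (fun N hN => h N (by simp [hN])) M hM' hb)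

/-- The stabilizer of a set. -/
def stab (L : Set R) : Subgroup (R ≃ₐ[k] R) where
  carrier := {τ | ∀ x, τ x ∈ L ↔ x ∈ L}
  one_mem' := by intro x; rfl
  mul_mem' := by
    intro a b ha hb x
    rw [AlgEquiv.mul_apply, ha, hb]
  inv_mem' := by
    intro a ha x
    rw [← ha (a⁻¹ x), ← AlgEquiv.mul_apply, mul_inv_cancel, AlgEquiv.one_apply]

theorem σpow_mem {n : ℕ} (σ : Fin n → R ≃ₐ[k] R) (S : Subgroup (R ≃ₐ[k] R)) (α : Fin n → ℤ)
    (h : ∀ i, α i ≠ 0 → σ i ∈ S) : σpow σ α ∈ S := by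
  apply Subgroup.list_prod_mem
  intro x hx
  obtain ⟨i, _, rfl⟩ := List.mem_map.1 hx
  by_cases hi : α i = 0
  · simp [hi]
  · exact S.zpow_mem (h i hi) _

theorem σpow_add {n : ℕ} (σ : Fin n → R ≃ₐ[k] R) (hc : ∀ i j, σ i * σ j = σ j * σ i)
    (α β : Fin n → ℤ) : σpow σ (α + β) = σpow σ α * σpow σ β :=
  list_prod_zpow_add σ hc α β _

theorem σpow_zero {n : ℕ} (σ : Fin n → R ≃ₐ[k] R) : σpow σ 0 = 1 :=
  list_prod_one _ _ (by simp)

theorem σpow_single {n : ℕ} (σ : Fin n → R ≃ₐ[k] R) (i : Fin n) (m : ℤ) :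
    σpow σ (Pi.single i m) = σ i ^ m := by
  unfold σpow
  rw [list_prod_single _ i _ (List.nodup_finRange n) (List.mem_finRange i)]
  · simp
  · intro j hj; simp [hj]

theorem map_stable {n : ℕ} (σ : Fin n → R ≃ₐ[k] R) (I : Ideal R)
    (h : ∀ β r, r ∈ I → σpow σ β r ∈ I) (i : Fin n) : Ideal.map (σ i) I = I := by
  apply le_antisymm
  · rw [Ideal.map_le_iff_le_comap]
    intro r hr
    have := h (Pi.single i 1) r hr
    rwa [σpow_single, zpow_one] at this
  · intro r hr
    have h1 := h (Pi.single i (-1)) r hr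
    rw [σpow_single, zpow_neg_one] at h1
    have h2 := Ideal.mem_map_of_mem (σ i) h1
    rwa [← AlgEquiv.mul_apply, mul_inv_cancel, AlgEquiv.one_apply] at h2

theorem stable_of_map {n : ℕ} (σ : Fin n → R ≃ₐ[k] R) (I : Ideal R)
    (h : ∀ i, Ideal.map (σ i) I = I) (β : Fin n → ℤ) (r : R) (hr : r ∈ I) :
    σpow σ β r ∈ I := by
  have : σpow σ β ∈ stab (k := k) (I : Set R) := by
    apply σpow_mem
    intro i _ x
    constructor
    · intro hx
      have hx' : σ i x ∈ Ideal.map (σ i) I := by rw [h i]; exact hx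
      obtain ⟨y, hy, hxy⟩ := (Ideal.mem_map_of_equiv (σ i) _).1 hx'
      rw [← (σ i).injective hxy]; exact hy
    · intro hx
      have := Ideal.mem_map_of_mem (σ i) hx
      rw [h i] at this; exact this
  exact (this r).2 hr

/-- The arithmetic heart of the statement that `σ^α = 1` forces the ideals to be trivial. -/
theorem one_mem_of_periodic {n : ℕ} (σ : Fin n → R ≃ₐ[k] R)
    (hc : ∀ i j, σ i * σ j = σ j * σ i)
    (hΓ : ∀ I : Ideal R, (∀ i, Ideal.map (σ i) I = I) → I = ⊥ ∨ I = ⊤)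
    (i : Fin n) (L : Submodule k R) (hL : ∀ r x : R, x ∈ L → r * x ∈ L)
    (hst : ∀ j, j ≠ i → σ j ∈ stab (k := k) (L : Set R)) (m : ℤ)
    (hm : σ i ^ m ∈ stab (k := k) (L : Set R)) (a : R) (ha : a ≠ 0)
    (hper : ∀ c : ℤ, ∃ q : ℤ, (σ i ^ (c + m * q)) a ∈ L) : (1 : R) ∈ L := by
  let D : Ideal R :=
    { carrier := {r | ∀ γ, σpow σ γ r ∈ L}
      zero_mem' := by intro γ; simp
      add_mem' := by intro x y hx hy γ; rw [map_add]; exact L.add_mem (hx γ) (hy γ)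
      smul_mem' := by intro r x hx γ; rw [smul_eq_mul, map_mul]; exact hL _ _ (hx γ) }
  have hD := hΓ D (map_stable σ D (by
    intro β r hr γ
    rw [← AlgEquiv.mul_apply, ← σpow_add σ hc]
    exact hr _))
  have haD : a ∈ D := by
    intro γ
    obtain ⟨q, hq⟩ := hper (γ i)
    have e : γ = (γ - Pi.single i (γ i)) + Pi.single i (γ i) := by simp
    rw [e, σpow_add σ hc, σpow_single, AlgEquiv.mul_apply]
    have h1 : σpow σ (γ - Pi.single i (γ i)) ∈ stab (k := k) (L : Set R) := by
      apply σpow_mem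
      intro j hj
      apply hst
      rintro rfl
      simp at hj
    refine (h1 _).2 ?_
    have h2 : (σ i ^ m) ^ q ∈ stab (k := k) (L : Set R) := Subgroup.zpow_mem _ hm q
    refine (h2 _).1 ?_
    rw [← AlgEquiv.mul_apply, ← zpow_mul, ← zpow_add, add_comm]
    exact hq
  rcases hD with h | h
  · rw [h] at haD
    exact absurd haD ha
  · have : (1 : R) ∈ D := by rw [h]; trivial
    have := this 0
    simpa using this

theorem mem_map_zpow {τ : R ≃ₐ[k] R} {L : Submodule k R} {m : ℤ} {a : R}
    (h : a ∈ L.map (τ ^ m).toLinearMap) : (τ ^ (-m)) a ∈ L := by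
  obtain ⟨y, hy, rfl⟩ := Submodule.mem_map.1 h
  rw [AlgEquiv.toLinearMap_apply, ← AlgEquiv.mul_apply, ← zpow_add]
  simpa using hy

theorem map_closed {τ : R ≃ₐ[k] R} {L : Submodule k R}
    (hL : ∀ r x : R, x ∈ L → r * x ∈ L) : ∀ r x : R, x ∈ L.map τ.toLinearMap →
    r * x ∈ L.map τ.toLinearMap := by
  rintro r x hx
  obtain ⟨y, hy, rfl⟩ := Submodule.mem_map.1 hx
  refine Submodule.mem_map.2 ⟨τ.symm r * y, hL _ _ hy, ?_⟩
  simp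

theorem seg_mem_J {τ : R ≃ₐ[k] R} {H J : Submodule k R}
    (hJ : ∀ r x : R, x ∈ J → r * x ∈ J) {m : ℤ} (hm : 0 < m) {a : R}
    (ha : a ∈ seg τ H J m) (j : ℤ) (hj : 0 ≤ j) (hjm : j < m) : (τ ^ (-j)) a ∈ J := by
  rw [seg, if_pos hm] at ha
  lift j to ℕ using hj
  refine mem_map_zpow (list_prod_le _ ?_ _ ?_ ha)
  · intro M hM
    obtain ⟨i, _, rfl⟩ := List.mem_map.1 hM
    exact map_closed hJ
  · exact List.mem_map.2 ⟨(j : ℤ), by simp; omega, rfl⟩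

theorem seg_mem_H {τ : R ≃ₐ[k] R} {H J : Submodule k R}
    (hH : ∀ r x : R, x ∈ H → r * x ∈ H) {m : ℤ} (hm : 0 < m) {a : R}
    (ha : a ∈ seg τ H J (-m)) (j : ℤ) (hj : 0 ≤ j) (hjm : j < m) : (τ ^ (j + 1)) a ∈ H := by
  rw [seg, if_neg (by omega), if_neg (by omega)] at ha
  lift j to ℕ using hj
  have := mem_map_zpow (τ := τ) (L := H) (m := -((j : ℤ) + 1)) (list_prod_le _ ?_ _ ?_ ha)
  · simpa only [neg_neg] using this
  · intro M hM
    obtain ⟨i, _, rfl⟩ := List.mem_map.1 hM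
    exact map_closed hH
  · exact List.mem_map.2 ⟨(j : ℤ), by simp; omega, rfl⟩

theorem one_mem_seg {τ : R ≃ₐ[k] R} {H J : Submodule k R} {m : ℤ}
    (h : m ≠ 0 → (1 : R) ∈ J ∧ (1 : R) ∈ H) : (1 : R) ∈ seg τ H J m := by
  have key : ∀ (L : Submodule k R) (ρ : R ≃ₐ[k] R), (1 : R) ∈ L →
      (1 : R) ∈ L.map ρ.toLinearMap := fun L ρ hL =>
    Submodule.mem_map.2 ⟨1, hL, by simp⟩
  unfold seg
  split_ifs with h1 h2
  · apply one_mem_list_prod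
    intro M hM
    obtain ⟨i, _, rfl⟩ := List.mem_map.1 hM
    exact key _ _ (h (by omega)).1
  · trivial
  · apply one_mem_list_prod
    intro M hM
    obtain ⟨i, _, rfl⟩ := List.mem_map.1 hM
    exact key _ _ (h (by omega)).2

theorem stab_of_map {τ : R ≃ₐ[k] R} {L : Submodule k R} (h : L.map τ.toLinearMap = L) :
    τ ∈ stab (k := k) (L : Set R) := by
  intro x
  constructor
  · intro hx
    have hx' : τ x ∈ L.map τ.toLinearMap := by rw [h]; exact hx
    obtain ⟨y, hy, hxy⟩ := Submodule.mem_map.1 hx'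
    rw [← τ.injective hxy]; exact hy
  · intro hx
    have : τ x ∈ L.map τ.toLinearMap := Submodule.mem_map.2 ⟨x, hx, rfl⟩
    rw [h] at this; exact this

theorem one_mem_segVec {n : ℕ} {σ : Fin n → R ≃ₐ[k] R} {p : Fin n → Fin n → kˣ}
    {H J : Fin n → Submodule k R} (hD : IsBRDatum σ p H J)
    (hΓ : ∀ I : Ideal R, (∀ i, Ideal.map (σ i) I = I) → I = ⊥ ∨ I = ⊤)
    (α : Fin n → ℤ) (hα : σpow σ α = 1) : (1 : R) ∈ segVec σ H J α := by
  apply one_mem_list_prod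
  intro M hM
  obtain ⟨i, _, rfl⟩ := List.mem_map.1 hM
  apply one_mem_seg
  intro hi
  have hper : ∀ L : Submodule k R, (∀ j, j ≠ i → σ j ∈ stab (k := k) (L : Set R)) →
      σ i ^ |α i| ∈ stab (k := k) (L : Set R) := by
    intro L hL
    have h1 : σ i ^ α i ∈ stab (k := k) (L : Set R) := by
      have e : α = (α - Pi.single i (α i)) + Pi.single i (α i) := by simp
      rw [e, σpow_add σ hD.comm, σpow_single] at hα
      rw [eq_inv_of_mul_eq_one_right hα]
      apply Subgroup.inv_mem
      apply σpow_mem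
      intro j hj
      apply hL
      rintro rfl
      simp at hj
    rcases abs_choice (α i) with h | h
    · rw [h]; exact h1
    · rw [h, zpow_neg]; exact Subgroup.inv_mem _ h1
  have hm : 0 < |α i| := abs_pos.2 hi
  constructor
  · obtain ⟨a, ha, ha0⟩ := Submodule.exists_mem_ne_zero_of_ne_bot (hD.seg_ne_bot i (|α i|))
    have hst : ∀ j, j ≠ i → σ j ∈ stab (k := k) (J i : Set R) := fun j hj =>
      stab_of_map (hD.mapJ j i hj)
    refine one_mem_of_periodic σ hD.comm hΓ i (J i) (hD.J_mul_left i) hst _ (hper _ hst) a ha0 ?_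
    intro c
    refine ⟨-(-(-c / |α i|)), ?_⟩
    have h3 := seg_mem_J (hD.J_mul_left i) hm ha ((-c) % |α i|)
      (Int.emod_nonneg _ hm.ne') (Int.emod_lt_of_pos _ hm)
    have h4 := Int.emod_add_mul_ediv (-c) |α i|
    have h5 : c + |α i| * -(-(-c / |α i|)) = -((-c) % |α i|) := by linarith
    rw [h5]; exact h3
  · obtain ⟨a, ha, ha0⟩ := Submodule.exists_mem_ne_zero_of_ne_bot (hD.seg_ne_bot i (-|α i|))
    have hst : ∀ j, j ≠ i → σ j ∈ stab (k := k) (H i : Set R) := fun j hj =>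
      stab_of_map (hD.mapH j i hj)
    refine one_mem_of_periodic σ hD.comm hΓ i (H i) (hD.H_mul_left i) hst _ (hper _ hst) a ha0 ?_
    intro c
    refine ⟨-((c - 1) / |α i|), ?_⟩
    have h3 := seg_mem_H (hD.H_mul_left i) hm ha ((c - 1) % |α i|)
      (Int.emod_nonneg _ hm.ne') (Int.emod_lt_of_pos _ hm)
    have h4 := Int.emod_add_mul_ediv (c - 1) |α i|
    have h5 : c + |α i| * -((c - 1) / |α i|) = (c - 1) % |α i| + 1 := by linarith
    rw [h5]; exact h3

end lists

section skew

variable {k R A : Type*} [Field k] [CommRing R] [Algebra k R] [Ring A] [Algebra k A]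
  {n : ℕ} {σ : Fin n → R ≃ₐ[k] R} {p : Fin n → Fin n → kˣ}

/-- Pairs (unit, automorphism) that are intertwined. -/
def interSub (E : SkewLaurent k σ p A) : Subgroup (Aˣ × (R ≃ₐ[k] R)) where
  carrier := {u | ∀ r, (u.1 : A) * E.ι r = E.ι (u.2 r) * (u.1 : A)}
  one_mem' := by intro r; simp
  mul_mem' := by
    intro a b ha hb r
    simp only [Prod.fst_mul, Prod.snd_mul, Units.val_mul, AlgEquiv.mul_apply]
    rw [mul_assoc, hb r, ← mul_assoc, ha, mul_assoc]
  inv_mem' := by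
    intro a ha r
    have h := ha (a.2⁻¹ r)
    rw [← AlgEquiv.mul_apply, mul_inv_cancel, AlgEquiv.one_apply] at h
    simp only [Prod.fst_inv, Prod.snd_inv]
    rw [Units.inv_mul_eq_iff_eq_mul, ← mul_assoc, h, mul_assoc, Units.mul_inv, mul_one]

theorem tpow_ι (E : SkewLaurent k σ p A) (α : Fin n → ℤ) (r : R) :
    (tpow E.t α : A) * E.ι r = E.ι (σpow σ α r) * (tpow E.t α : A) := by
  have h : ((List.finRange n).map fun i => ((E.t i, σ i) : Aˣ × (R ≃ₐ[k] R)) ^ α i).prod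
      ∈ interSub E := by
    apply Subgroup.list_prod_mem
    intro x hx
    obtain ⟨i, _, rfl⟩ := List.mem_map.1 hx
    apply Subgroup.zpow_mem
    exact E.rel_r i
  have e : ((List.finRange n).map fun i => ((E.t i, σ i) : Aˣ × (R ≃ₐ[k] R)) ^ α i).prod
      = (tpow E.t α, σpow σ α) := by
    apply Prod.ext
    · have := map_list_prod (MonoidHom.fst Aˣ (R ≃ₐ[k] R))
        ((List.finRange n).map fun i => ((E.t i, σ i) : Aˣ × (R ≃ₐ[k] R)) ^ α i)
      rw [List.map_map] at this
      exact this
    · have := map_list_prod (MonoidHom.snd Aˣ (R ≃ₐ[k] R))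
        ((List.finRange n).map fun i => ((E.t i, σ i) : Aˣ × (R ≃ₐ[k] R)) ^ α i)
      rw [List.map_map] at this
      exact this
  rw [e] at h
  exact h r

theorem tpow_zero (t : Fin n → Aˣ) : tpow t 0 = 1 :=
  list_prod_one _ _ (by simp)

theorem tpow_add (E : SkewLaurent k σ p A) (α β : Fin n → ℤ) :
    ∃ q : kˣ, (tpow E.t α : A) * (tpow E.t β : A) =
      E.ι (algebraMap k R q) * (tpow E.t (α + β) : A) := by
  let φ : kˣ →* Aˣ := Units.map (algebraMap k A : k →* A)
  let N : Subgroup Aˣ := φ.range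
  have hcen : ∀ (c : kˣ) (u : Aˣ), φ c * u = u * φ c := by
    intro c u
    ext
    exact Algebra.commutes (c : k) (u : A)
  have : N.Normal := by
    constructor
    rintro _ ⟨c, rfl⟩ g
    rw [← hcen, mul_assoc, mul_inv_cancel, mul_one]
    exact ⟨c, rfl⟩
  let π : Aˣ →* Aˣ ⧸ N := QuotientGroup.mk' N
  have hcomm : ∀ i j, Commute (π (E.t i)) (π (E.t j)) := by
    intro i j
    by_cases hij : i = j
    · subst hij; exact Commute.refl _
    · change π (E.t i) * π (E.t j) = π (E.t j) * π (E.t i)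
      rw [← map_mul, ← map_mul]
      refine QuotientGroup.eq.2 ?_
      refine ⟨p i j, ?_⟩
      rw [eq_inv_mul_iff_mul_eq, ← hcen]
      ext
      exact (E.rel_t i j hij).symm
  have hπ : ∀ γ, π (tpow E.t γ) = ((List.finRange n).map fun i => π (E.t i) ^ γ i).prod := by
    intro γ
    unfold tpow
    rw [map_list_prod, List.map_map]
    congr 1
  have h : π (tpow E.t (α + β)) = π (tpow E.t α * tpow E.t β) := by
    rw [map_mul, hπ, hπ, hπ]
    exact list_prod_zpow_add _ hcomm α β _
  obtain ⟨c, hc⟩ := QuotientGroup.eq.1 h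
  refine ⟨c, ?_⟩
  rw [eq_inv_mul_iff_mul_eq, ← hcen] at hc
  have := congrArg (Units.val) hc
  rw [AlgHom.commutes]
  exact this.symm

/-- The linear map sending finitely supported functions to the Laurent extension. -/
noncomputable def toA (E : SkewLaurent k σ p A) : ((Fin n → ℤ) →₀ R) →ₗ[k] A where
  toFun c := c.sum fun α r => E.ι r * (tpow E.t α : A)
  map_add' := by
    intro c d
    exact Finsupp.sum_add_index' (by simp) (by intros; rw [map_add, add_mul])
  map_smul' := by
    intro a c
    rw [Finsupp.sum_smul_index' (by simp), Finsupp.smul_sum]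
    simp

theorem toA_bij (E : SkewLaurent k σ p A) : Function.Bijective (toA E) := by
  constructor
  · rw [injective_iff_map_eq_zero]
    exact E.repr_free
  · intro a
    obtain ⟨c, hc⟩ := E.repr_exists a
    exact ⟨c, hc.symm⟩

/-- Coefficients. -/
noncomputable def coef (E : SkewLaurent k σ p A) : A ≃ₗ[k] ((Fin n → ℤ) →₀ R) :=
  (LinearEquiv.ofBijective (toA E) (toA_bij E)).symm

theorem coef_mono (E : SkewLaurent k σ p A) (r : R) (α : Fin n → ℤ) :
    coef E (E.ι r * (tpow E.t α : A)) = Finsupp.single α r := by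
  unfold coef
  rw [LinearEquiv.symm_apply_eq]
  simp [toA]

theorem coef_add (E : SkewLaurent k σ p A) (x y : A) (α : Fin n → ℤ) :
    coef E (x + y) α = coef E x α + coef E y α := by
  rw [LinearEquiv.map_add]; rfl

theorem coef_sub (E : SkewLaurent k σ p A) (x y : A) (α : Fin n → ℤ) :
    coef E (x - y) α = coef E x α - coef E y α := by
  rw [_root_.map_sub (coef E) x y]; rfl

theorem coef_ι (E : SkewLaurent k σ p A) (r : R) :
    coef E (E.ι r) = Finsupp.single 0 r := by
  rw [← coef_mono E, tpow_zero]; simp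

theorem coef_sum (E : SkewLaurent k σ p A) (x : A) :
    x = (coef E x).sum fun α r => E.ι r * (tpow E.t α : A) :=
  ((LinearEquiv.ofBijective (toA E) (toA_bij E)).apply_symm_apply x).symm

theorem A_induction (E : SkewLaurent k σ p A) (P : A → Prop) (h0 : P 0)
    (hadd : ∀ x y, P x → P y → P (x + y))
    (hm : ∀ r α, P (E.ι r * (tpow E.t α : A))) (x : A) : P x := by
  rw [coef_sum E x]
  unfold Finsupp.sum
  exact Finset.sum_induction _ P hadd h0 (fun α _ => hm _ α)

theorem coef_ext (E : SkewLaurent k σ p A) {x y : A} (h : ∀ α, coef E x α = coef E y α) :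
    x = y := (coef E).injective (Finsupp.ext h)

/-- The structure constants. -/
noncomputable def Qc (E : SkewLaurent k σ p A) (α β : Fin n → ℤ) : R :=
  algebraMap k R ((tpow_add E α β).choose : kˣ)

theorem Qc_spec (E : SkewLaurent k σ p A) (α β : Fin n → ℤ) :
    (tpow E.t α : A) * (tpow E.t β : A) = E.ι (Qc E α β) * (tpow E.t (α + β) : A) :=
  (tpow_add E α β).choose_spec

theorem Qc_unit (E : SkewLaurent k σ p A) (α β : Fin n → ℤ) : IsUnit (Qc E α β) :=
  (Units.isUnit _).map (algebraMap k R)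

theorem Qc_zero_left (E : SkewLaurent k σ p A) (β : Fin n → ℤ) : Qc E 0 β = 1 := by
  have h := Qc_spec E 0 β
  rw [tpow_zero, zero_add, Units.val_one, one_mul] at h
  have h1 := congrArg (coef E) h
  rw [coef_mono, ← one_mul (tpow E.t β : A), ← map_one E.ι, coef_mono] at h1
  exact (Finsupp.single_injective β h1).symm

theorem Qc_zero_right (E : SkewLaurent k σ p A) (β : Fin n → ℤ) : Qc E β 0 = 1 := by
  have h := Qc_spec E β 0
  rw [tpow_zero, add_zero, Units.val_one, mul_one] at h
  have h1 := congrArg (coef E) h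
  rw [coef_mono, ← one_mul (tpow E.t β : A), ← map_one E.ι, coef_mono] at h1
  exact (Finsupp.single_injective β h1).symm

theorem mono_mul_mono (E : SkewLaurent k σ p A) (a b : R) (α β : Fin n → ℤ) :
    (E.ι a * (tpow E.t α : A)) * (E.ι b * (tpow E.t β : A)) =
      E.ι (a * σpow σ α b * Qc E α β) * (tpow E.t (α + β) : A) := by
  rw [mul_assoc, ← mul_assoc (tpow E.t α : A), tpow_ι, mul_assoc, Qc_spec]
  simp only [map_mul, mul_assoc]

theorem coef_mul_mono (E : SkewLaurent k σ p A) (x : A) (c : R) (α β : Fin n → ℤ) :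
    coef E (x * (E.ι c * (tpow E.t β : A))) (α + β) =
      coef E x α * σpow σ α c * Qc E α β := by
  induction x using A_induction E with
  | h0 => simp
  | hadd x y hx hy => rw [add_mul, coef_add, coef_add, hx, hy]; ring
  | hm r γ =>
    rw [mono_mul_mono, coef_mono, coef_mono]
    by_cases h : γ = α
    · subst h; simp
    · rw [Finsupp.single_eq_of_ne (by simpa using Ne.symm h),
        Finsupp.single_eq_of_ne (Ne.symm h)]
      simp

theorem coef_mono_mul (E : SkewLaurent k σ p A) (x : A) (c : R) (α β : Fin n → ℤ) :
    coef E ((E.ι c * (tpow E.t β : A)) * x) (β + α) =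
      c * σpow σ β (coef E x α) * Qc E β α := by
  induction x using A_induction E with
  | h0 => simp
  | hadd x y hx hy => rw [mul_add, coef_add, coef_add, hx, hy, map_add]; ring
  | hm r γ =>
    rw [mono_mul_mono, coef_mono, coef_mono]
    by_cases h : γ = α
    · subst h; simp
    · rw [Finsupp.single_eq_of_ne (by simpa using Ne.symm h),
        Finsupp.single_eq_of_ne (Ne.symm h)]
      simp

theorem coef_ι_mul (E : SkewLaurent k σ p A) (x : A) (c : R) (α : Fin n → ℤ) :
    coef E (E.ι c * x) α = c * coef E x α := by
  have h := coef_mono_mul E x c α 0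
  rwa [tpow_zero, Units.val_one, mul_one, zero_add, σpow_zero, Qc_zero_left, mul_one] at h

theorem coef_mul_ι (E : SkewLaurent k σ p A) (x : A) (c : R) (α : Fin n → ℤ) :
    coef E (x * E.ι c) α = coef E x α * σpow σ α c := by
  have h := coef_mul_mono E x c α 0
  rwa [tpow_zero, Units.val_one, mul_one, add_zero, Qc_zero_right, mul_one] at h

theorem mem_B_iff (E : SkewLaurent k σ p A) (H J : Fin n → Submodule k R) (B : Subalgebra k A)
    (hB : Subalgebra.toSubmodule B = brSubmodule E H J) (x : A) :
    x ∈ B ↔ ∀ α, coef E x α ∈ segVec σ H J α := by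
  rw [← Subalgebra.mem_toSubmodule, hB]
  constructor
  · intro hx α
    let N : Submodule k A := (segVec σ H J α).comap
      ((Finsupp.lapply α : ((Fin n → ℤ) →₀ R) →ₗ[k] R) ∘ₗ (coef E).toLinearMap)
    have : brSubmodule E H J ≤ N := by
      refine iSup_le ?_
      intro β y hy
      obtain ⟨z, hz, rfl⟩ := Submodule.mem_map.1 hy
      obtain ⟨r, hr, rfl⟩ := Submodule.mem_map.1 hz
      change coef E (E.ι r * (tpow E.t β : A)) α ∈ segVec σ H J α
      rw [coef_mono]
      by_cases h : β = α
      · subst h; simpa using hr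
      · rw [Finsupp.single_eq_of_ne (Ne.symm h)]; exact Submodule.zero_mem _
    exact this hx
  · intro h
    rw [coef_sum E x]
    refine Submodule.sum_mem _ ?_
    intro α _
    refine Submodule.mem_iSup_of_mem α ?_
    exact Submodule.mem_map.2 ⟨_, Submodule.mem_map.2 ⟨_, h α, rfl⟩, rfl⟩

theorem mono_mem_B (E : SkewLaurent k σ p A) (H J : Fin n → Submodule k R) (B : Subalgebra k A)
    (hB : Subalgebra.toSubmodule B = brSubmodule E H J) {c : R} {α : Fin n → ℤ}
    (hc : c ∈ segVec σ H J α) : E.ι c * (tpow E.t α : A) ∈ B := by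
  rw [mem_B_iff E H J B hB]
  intro β
  rw [coef_mono]
  by_cases h : α = β
  · subst h; simpa using hc
  · rw [Finsupp.single_eq_of_ne (Ne.symm h)]; exact Submodule.zero_mem _

theorem segVec_ne [IsDomain R] {H J : Fin n → Submodule k R} (hD : IsBRDatum σ p H J)
    (α : Fin n → ℤ) : ∃ c ∈ segVec σ H J α, c ≠ 0 := by
  apply list_prod_ne_bot
  intro M hM
  obtain ⟨i, _, rfl⟩ := List.mem_map.1 hM
  exact hD.seg_ne_bot i _

end skew

section simple

theorem one_mem_of_simple {k B : Type*} [Field k] [Ring B] [Algebra k B] (hs : IsSimpleRing B)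
    (M : Submodule k B) (hl : ∀ a x, x ∈ M → a * x ∈ M) (hr : ∀ a x, x ∈ M → x * a ∈ M)
    (x : B) (hx : x ∈ M) (hx0 : x ≠ 0) : (1 : B) ∈ M := by
  let I : TwoSidedIdeal B := TwoSidedIdeal.mk' (M : Set B) M.zero_mem
    (fun ha hb => M.add_mem ha hb) (fun ha => M.neg_mem ha)
    (fun {a b} hb => hl a b hb) (fun {a b} ha => hr b a ha)
  have hI : ∀ y, y ∈ I ↔ y ∈ M := by
    intro y
    exact TwoSidedIdeal.mem_mk' _ _ _ _ _ _ y
  rcases eq_bot_or_eq_top I with h | h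
  · have : x ∈ I := (hI x).2 hx
    rw [h] at this
    exact absurd ((TwoSidedIdeal.mem_bot B).1 this) hx0
  · rw [← hI, h]; trivial

theorem simple_of {B : Type*} [Ring B] [Nontrivial B]
    (h : ∀ (I : TwoSidedIdeal B) (x : B), x ∈ I → x ≠ 0 → (1 : B) ∈ I) : IsSimpleRing B := by
  refine ⟨⟨fun I => ?_⟩⟩
  by_cases hI : ∃ x ∈ I, x ≠ 0
  · obtain ⟨x, hx, hx0⟩ := hI
    right
    exact TwoSidedIdeal.one_mem_iff I |>.1 (h I x hx hx0)
  · left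
    push Not at hI
    rw [eq_bot_iff]
    intro x hx
    exact (TwoSidedIdeal.mem_bot B).2 (hI x hx)

variable {k R A : Type*} [Field k] [CommRing R] [IsDomain R]
  [Algebra k R] [Ring A] [Algebra k A]
  {n : ℕ} {σ : Fin n → R ≃ₐ[k] R} {p : Fin n → Fin n → kˣ}

/-- No element `1 + a t^α` with `a ≠ 0`, `α ≠ 0` has a left inverse. -/
theorem no_left_inv (E : SkewLaurent k σ p A) (a : R) (α : Fin n → ℤ) (ha : a ≠ 0) (hα : α ≠ 0)
    (w : A) (hw : w * (1 + E.ι a * (tpow E.t α : A)) = 1) : False := by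
  have h1 : ∀ β, β + α ≠ 0 → (coef E w (β + α) ≠ 0 ↔ coef E w β ≠ 0) := by
    intro β hβ
    have h := congrArg (fun y => coef E y (β + α)) hw
    simp only [mul_add, mul_one, coef_add, coef_mul_mono] at h
    rw [← map_one E.ι, coef_ι, Finsupp.single_eq_of_ne hβ] at h
    have hs : σpow σ β a ≠ 0 := by simpa using ha
    have hq := (Qc_unit E β α).ne_zero
    constructor
    · intro h2 h3
      rw [h3] at h; simp at h; exact h2 h
    · intro h2 h3
      rw [h3, zero_add] at h
      exact mul_ne_zero (mul_ne_zero h2 hs) hq h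
  have hw0 : w ≠ 0 := by
    rintro rfl
    rw [zero_mul] at hw
    have := congrArg (fun y => coef E y 0) hw
    simp only [map_zero] at this
    rw [← map_one E.ι, coef_ι] at this
    simp at this
  have hc0 : coef E w ≠ 0 := by simpa using hw0
  obtain ⟨β, hβ⟩ := Finsupp.ne_iff.1 hc0
  simp only [Finsupp.coe_zero, Pi.zero_apply] at hβ
  have hfin : ∀ ε : ℤ, ε ≠ 0 → ¬ ∀ j : ℕ, coef E w (β + (ε * (j : ℤ)) • α) ≠ 0 := by
    intro ε hε hall
    have hinj : Function.Injective (fun j : ℕ => β + (ε * (j : ℤ)) • α) := by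
      intro i j hij
      have h2 : (ε * (i : ℤ)) • α = (ε * (j : ℤ)) • α := add_left_cancel hij
      have h3 := smul_left_injective ℤ hα h2
      exact_mod_cast mul_left_cancel₀ hε h3
    refine (Set.infinite_of_injective_forall_mem hinj (s := ((coef E w).support : Set _)) ?_)
      (Finset.finite_toSet _)
    intro j
    simpa using hall j
  by_cases hex : ∃ j : ℕ, β + ((j : ℤ) + 1) • α = 0
  · obtain ⟨j, hj⟩ := hex
    refine hfin (-1) (by norm_num) ?_
    intro i
    induction i with
    | zero => simpa using hβ
    | succ i ih =>
      have e : β + (-1 * (i : ℤ)) • α = (β + (-1 * ((i + 1 : ℕ) : ℤ)) • α) + α := by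
        push_cast; module
      rw [e, h1] at ih
      · exact ih
      · rw [← e]
        have : β + (-1 * (i : ℤ)) • α = -((i : ℤ) + j + 1) • α := by
          rw [eq_neg_of_add_eq_zero_left hj]; module
        rw [this]
        exact smul_ne_zero (by omega) hα
  · push Not at hex
    refine hfin 1 (by norm_num) ?_
    intro i
    induction i with
    | zero => simpa using hβ
    | succ i ih =>
      have e : β + (1 * ((i + 1 : ℕ) : ℤ)) • α = (β + (1 * (i : ℤ)) • α) + α := by
        push_cast; module
      rw [e, h1]
      · exact ih
      · rw [← e]
        have := hex i
        push_cast
        rwa [one_mul]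

variable {H J : Fin n → Submodule k R}

theorem forward_center (hD : IsBRDatum σ p H J)
    (E : SkewLaurent k σ p A) (B : Subalgebra k A)
    (hB : Subalgebra.toSubmodule B = brSubmodule E H J)
    (ιB : R →ₐ[k] ↥B) (hιB : ∀ r : R, ((ιB r : ↥B) : A) = E.ι r)
    (hs : IsSimpleRing ↥B) (z : ↥B) (hz : ∀ y : ↥B, z * y = y * z) : ∃ r : R, z = ιB r := by
  by_cases hcase : ∀ α, α ≠ 0 → coef E z α = 0
  · refine ⟨coef E z 0, ?_⟩
    apply Subtype.ext
    rw [hιB]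
    apply coef_ext E
    intro α
    rw [coef_ι]
    by_cases h : α = 0
    · subst h; simp
    · rw [hcase α h, Finsupp.single_eq_of_ne h]
  exfalso
  push Not at hcase
  obtain ⟨α, hα, hzα⟩ := hcase
  have hrel : ∀ β c, c ∈ segVec σ H J β →
      coef E z α * σpow σ α c * Qc E α β = c * σpow σ β (coef E z α) * Qc E β α := by
    intro β c hc
    have h := congrArg Subtype.val (hz ⟨_, mono_mem_B E H J B hB hc⟩)
    have h2 := congrArg (fun y => coef E y (α + β)) h
    simp only [MulMemClass.coe_mul, coef_mul_mono] at h2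
    rw [add_comm α β, coef_mono_mul] at h2
    exact h2
  have hmem := (mem_B_iff E H J B hB z).1 z.2
  let z' : ↥B := ⟨_, mono_mem_B E H J B hB (hmem α)⟩
  have hz' : ∀ y : ↥B, z' * y = y * z' := by
    intro y
    apply Subtype.ext
    apply coef_ext E
    intro γ
    obtain ⟨β, rfl⟩ : ∃ β, γ = α + β := ⟨γ - α, by abel⟩
    have h1 := coef_mono_mul E y (coef E z α) β α
    have h2 := coef_mul_mono E y (coef E z α) β α
    rw [add_comm β α] at h2
    refine h1.trans (Eq.trans ?_ h2.symm)
    exact hrel β _ ((mem_B_iff E H J B hB y).1 y.2 β)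
  have h1 := one_mem_of_simple hs (LinearMap.range (LinearMap.mulRight k (1 + z')))
    (by
      rintro a _ ⟨w, rfl⟩
      exact ⟨a * w, by simp [mul_assoc]⟩)
    (by
      rintro a _ ⟨w, rfl⟩
      refine ⟨w * a, ?_⟩
      simp only [LinearMap.mulRight_apply, mul_add, add_mul, mul_assoc, hz' a, mul_one, one_mul])
    (1 + z') ⟨1, by simp⟩ (by
      intro h
      have h2 := congrArg (fun y : ↥B => coef E (y : A) α) h
      simp only [AddMemClass.coe_add, OneMemClass.coe_one, coef_add, ZeroMemClass.coe_zero,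
        map_zero] at h2
      rw [← map_one E.ι, coef_ι, Finsupp.single_eq_of_ne hα, coef_mono] at h2
      simp at h2
      exact hzα h2)
  obtain ⟨w, hw⟩ := h1
  have hw' := congrArg Subtype.val hw
  exact no_left_inv E _ α hzα hα w hw'

theorem forward_gamma (E : SkewLaurent k σ p A) (B : Subalgebra k A)
    (ιB : R →ₐ[k] ↥B) (hιB : ∀ r : R, ((ιB r : ↥B) : A) = E.ι r)
    (hs : IsSimpleRing ↥B) (I : Ideal R) (hI : ∀ i, Ideal.map (σ i) I = I) :
    I = ⊥ ∨ I = ⊤ := by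
  by_cases hbot : I = ⊥
  · exact Or.inl hbot
  right
  obtain ⟨r, hr, hr0⟩ := Submodule.exists_mem_ne_zero_of_ne_bot hbot
  let M : Submodule k ↥B :=
    { carrier := {b | ∀ α, coef E (b : A) α ∈ I}
      zero_mem' := by intro α; simp
      add_mem' := by
        intro a b ha hb α
        rw [AddMemClass.coe_add, coef_add]
        exact I.add_mem (ha α) (hb α)
      smul_mem' := by
        intro c x hx α
        rw [SetLike.val_smul, LinearEquiv.map_smul, Finsupp.smul_apply, Algebra.smul_def]
        exact I.mul_mem_left _ (hx α) }
  have hr1 : ∀ (a : A) (x : A), (∀ α, coef E x α ∈ I) → ∀ α, coef E (x * a) α ∈ I := by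
    intro a x hx
    induction a using A_induction E with
    | h0 => simp
    | hadd a b ha hb =>
      intro α
      rw [mul_add, coef_add]
      exact I.add_mem (ha α) (hb α)
    | hm c β =>
      intro γ
      obtain ⟨δ, rfl⟩ : ∃ δ, γ = δ + β := ⟨γ - β, by abel⟩
      rw [coef_mul_mono]
      exact I.mul_mem_right _ (I.mul_mem_right _ (hx δ))
  have hl1 : ∀ (a : A) (x : A), (∀ α, coef E x α ∈ I) → ∀ α, coef E (a * x) α ∈ I := by
    intro a x hx
    induction a using A_induction E with
    | h0 => simp
    | hadd a b ha hb =>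
      intro α
      rw [add_mul, coef_add]
      exact I.add_mem (ha α) (hb α)
    | hm c β =>
      intro γ
      obtain ⟨δ, rfl⟩ : ∃ δ, γ = β + δ := ⟨γ - β, by abel⟩
      rw [coef_mono_mul]
      exact I.mul_mem_right _ (I.mul_mem_left _ (stable_of_map σ I hI β _ (hx δ)))
  have hmem : ιB r ∈ M := by
    intro α
    rw [hιB, coef_ι]
    by_cases h : α = 0
    · subst h; simpa using hr
    · rw [Finsupp.single_eq_of_ne h]; exact I.zero_mem
  have hne : ιB r ≠ 0 := by
    intro h
    have h2 := congrArg (fun y : ↥B => coef E (y : A) 0) h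
    simp only [hιB, coef_ι] at h2
    simp at h2
    exact hr0 h2
  have h1 := one_mem_of_simple hs M (fun a x hx => hl1 a x hx) (fun a x hx => hr1 a x hx)
    _ hmem hne 0
  rw [OneMemClass.coe_one, ← map_one E.ι, coef_ι, Finsupp.single_eq_same] at h1
  exact (Ideal.eq_top_iff_one I).2 h1

/-- Every nonzero ideal meets `R`. -/
theorem meets (hD : IsBRDatum σ p H J)
    (E : SkewLaurent k σ p A) (B : Subalgebra k A)
    (hB : Subalgebra.toSubmodule B = brSubmodule E H J)
    (ιB : R →ₐ[k] ↥B) (hιB : ∀ r : R, ((ιB r : ↥B) : A) = E.ι r)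
    (hΓ : ∀ I : Ideal R, (∀ i, Ideal.map (σ i) I = I) → I = ⊥ ∨ I = ⊤)
    (hZ : ∀ z : ↥B, (∀ y : ↥B, z * y = y * z) → ∃ r : R, z = ιB r)
    (I : TwoSidedIdeal ↥B) (x : ↥B) (hx : x ∈ I) (hx0 : x ≠ 0) :
    ∃ r : R, r ≠ 0 ∧ ιB r ∈ I := by
  classical
  -- an element of minimal support
  have hmin : ∃ f : ↥B, f ∈ I ∧ f ≠ 0 ∧ ∀ g : ↥B, g ∈ I →
      (coef E (g : A)).support.card < (coef E (f : A)).support.card → g = 0 := by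
    let P : ℕ → Prop := fun m => ∃ f : ↥B, f ∈ I ∧ f ≠ 0 ∧ (coef E (f : A)).support.card = m
    have hP : ∃ m, P m := ⟨_, x, hx, hx0, rfl⟩
    obtain ⟨f, hf, hf0, hfm⟩ := Nat.find_spec hP
    refine ⟨f, hf, hf0, fun g hg hlt => ?_⟩
    by_contra hg0
    rw [hfm] at hlt
    exact Nat.find_min hP hlt ⟨g, hg, hg0, rfl⟩
  -- translate it so that it has a constant term
  obtain ⟨f, hf, hf0, hfmin⟩ : ∃ f : ↥B, f ∈ I ∧ coef E (f : A) 0 ≠ 0 ∧ ∀ g : ↥B, g ∈ I →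
      (coef E (g : A)).support.card < (coef E (f : A)).support.card → g = 0 := by
    obtain ⟨f, hf, hf0, hfmin⟩ := hmin
    have hc0 : coef E (f : A) ≠ 0 := by simpa using hf0
    obtain ⟨α, hα⟩ := Finsupp.ne_iff.1 hc0
    simp only [Finsupp.coe_zero, Pi.zero_apply] at hα
    obtain ⟨c, hc, hcne⟩ := segVec_ne hD (-α)
    let b : ↥B := ⟨_, mono_mem_B E H J B hB hc⟩
    have hco : ∀ γ, coef E ((f * b : ↥B) : A) (γ + -α) =
        coef E (f : A) γ * σpow σ γ c * Qc E γ (-α) := fun γ => coef_mul_mono E f c γ (-α)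
    refine ⟨f * b, I.mul_mem_right _ _ hf, ?_, ?_⟩
    · have := hco α
      rw [add_neg_cancel] at this
      rw [this]
      exact mul_ne_zero (mul_ne_zero hα (by simpa using hcne)) (Qc_unit E _ _).ne_zero
    · intro g hg hlt
      refine hfmin g hg (lt_of_lt_of_le hlt ?_)
      have hsub : (coef E ((f * b : ↥B) : A)).support ⊆
          (coef E (f : A)).support.image (fun γ => γ + -α) := by
        intro δ hδ
        rw [Finset.mem_image]
        refine ⟨δ + α, ?_, by abel⟩
        rw [Finsupp.mem_support_iff] at hδ ⊢
        intro h
        apply hδ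
        have := hco (δ + α)
        rw [h, zero_mul, zero_mul, add_neg_cancel_right] at this
        exact this
      exact (Finset.card_le_card hsub).trans Finset.card_image_le
  set f0 := coef E (f : A) 0 with hf0def
  have small : ∀ (g : ↥B) (β : Fin n → ℤ), g ∈ I → coef E (g : A) β = 0 →
      (∀ γ, coef E (f : A) γ = 0 → coef E (g : A) (γ + β) = 0) → g = 0 := by
    intro g β hg h0 h
    apply hfmin g hg
    have hsub : (coef E (g : A)).support ⊆
        ((coef E (f : A)).support.erase 0).image (fun γ => γ + β) := by
      intro δ hδ
      rw [Finsupp.mem_support_iff] at hδ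
      rw [Finset.mem_image]
      refine ⟨δ - β, ?_, by abel⟩
      rw [Finset.mem_erase, Finsupp.mem_support_iff]
      constructor
      · intro h1
        rw [sub_eq_zero.1 h1] at hδ
        exact hδ h0
      · intro h1
        have := h _ h1
        rw [sub_add_cancel] at this
        exact hδ this
    refine lt_of_le_of_lt ((Finset.card_le_card hsub).trans Finset.card_image_le) ?_
    exact Finset.card_erase_lt_of_mem (by rw [Finsupp.mem_support_iff]; exact hf0)
  -- the automorphisms in the support are trivial
  have hσ : ∀ α, coef E (f : A) α ≠ 0 → σpow σ α = 1 := by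
    intro α hα
    ext r
    have hco : ∀ γ, coef E ((ιB r * f - f * ιB r : ↥B) : A) γ =
        r * coef E (f : A) γ - coef E (f : A) γ * σpow σ γ r := by
      intro γ
      rw [AddSubgroupClass.coe_sub, MulMemClass.coe_mul, MulMemClass.coe_mul, hιB, coef_sub,
        coef_ι_mul, coef_mul_ι]
    have hg := small (ιB r * f - f * ιB r) 0
      (I.sub_mem (I.mul_mem_left _ _ hf) (I.mul_mem_right _ _ hf))
      (by rw [hco, σpow_zero, AlgEquiv.one_apply]; ring)
      (by intro γ hγ; rw [add_zero, hco, hγ]; ring)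
    have h1 := hco α
    rw [hg] at h1
    simp only [ZeroMemClass.coe_zero, map_zero, Finsupp.coe_zero, Pi.zero_apply] at h1
    have h2 : coef E (f : A) α * (σpow σ α r) = coef E (f : A) α * r := by
      linear_combination h1
    exact mul_left_cancel₀ hα h2
  -- the key relation
  have hrel : ∀ α β, coef E (f : A) α ≠ 0 →
      σpow σ β f0 * coef E (f : A) α * Qc E α β =
        f0 * σpow σ β (coef E (f : A) α) * Qc E β α := by
    intro α β hα
    obtain ⟨c, hc, hcne⟩ := segVec_ne hD β
    let b : ↥B := ⟨_, mono_mem_B E H J B hB hc⟩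
    let g : ↥B := ιB (σpow σ β f0) * (f * b) - ιB f0 * (b * f)
    have hco : ∀ γ, coef E (g : A) (γ + β) =
        σpow σ β f0 * (coef E (f : A) γ * σpow σ γ c * Qc E γ β) -
          f0 * (c * σpow σ β (coef E (f : A) γ) * Qc E β γ) := by
      intro γ
      have h1 := coef_mul_mono E f c γ β
      have h2 := coef_mono_mul E f c γ β
      rw [add_comm β γ] at h2
      rw [← h1, ← h2, ← coef_ι_mul, ← coef_ι_mul, ← coef_sub, ← hιB (σpow σ β f0), ← hιB f0]
      rfl
    have hg := small g β
      (I.sub_mem (I.mul_mem_left _ _ (I.mul_mem_right _ _ hf))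
        (I.mul_mem_left _ _ (I.mul_mem_left _ _ hf)))
      (by
        have := hco 0
        rw [zero_add] at this
        rw [this, σpow_zero, AlgEquiv.one_apply, Qc_zero_left, Qc_zero_right, ← hf0def]
        ring)
      (by intro γ hγ; rw [hco, hγ, map_zero]; ring)
    have h1 := hco α
    rw [hg, hσ α hα, AlgEquiv.one_apply] at h1
    simp only [ZeroMemClass.coe_zero, map_zero, Finsupp.coe_zero, Pi.zero_apply] at h1
    apply mul_left_cancel₀ hcne
    linear_combination -h1
  -- everything but the constant term vanishes
  have hvan : ∀ α, α ≠ 0 → coef E (f : A) α = 0 := by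
    intro α hα
    by_contra hfα
    set fα := coef E (f : A) α with hfαdef
    let D : Ideal R :=
      { carrier := {r | f0 ∣ r * fα}
        zero_mem' := by simp
        add_mem' := by intro a b ha hb; simp only [Set.mem_ofPred_eq, add_mul]; exact dvd_add ha hb
        smul_mem' := by
          intro r a ha
          simp only [Set.mem_ofPred_eq, smul_eq_mul, mul_assoc]
          exact Dvd.dvd.mul_left ha r }
    have hDst : ∀ β r, r ∈ D → σpow σ β r ∈ D := by
      rintro β r ⟨u, hu⟩
      have h1 := congrArg (σpow σ β) hu
      rw [map_mul, map_mul] at h1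
      have h2 := hrel α β hfα
      have hs0 : σpow σ β f0 ≠ 0 := by simpa using hf0
      have h3 : σpow σ β r * fα * Qc E α β = f0 * (σpow σ β u * Qc E β α) := by
        apply mul_left_cancel₀ hs0
        linear_combination (σpow σ β r) * h2 + f0 * Qc E β α * h1
      exact (Qc_unit E α β).dvd_mul_right.1 ⟨_, h3⟩
    have hDtop : (1 : R) ∈ D := by
      rcases hΓ D (map_stable σ D hDst) with h | h
      · have : f0 ∈ D := Dvd.intro _ rfl
        rw [h] at this
        exact absurd this hf0
      · rw [h]; trivial
    obtain ⟨c, hc⟩ := hDtop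
    rw [one_mul] at hc
    have hc0 : c ≠ 0 := by
      rintro rfl
      rw [mul_zero] at hc
      exact hfα hc
    have hcrel : ∀ β, c * Qc E α β = σpow σ β c * Qc E β α := by
      intro β
      have h2 := hrel α β hfα
      have hs0 : σpow σ β f0 ≠ 0 := by simpa using hf0
      rw [← hfαdef, hc, map_mul] at h2
      apply mul_left_cancel₀ (mul_ne_zero hf0 hs0)
      linear_combination h2
    have hone := one_mem_segVec hD hΓ α (hσ α hfα)
    have hcα : c ∈ segVec σ H J α := by
      have h1 := (ιB c * ⟨_, mono_mem_B E H J B hB hone⟩ : ↥B).2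
      rw [MulMemClass.coe_mul, hιB] at h1
      have h2 := (mem_B_iff E H J B hB _).1 h1 α
      rw [coef_ι_mul, coef_mono] at h2
      simpa using h2
    obtain ⟨r, hr⟩ := hZ ⟨_, mono_mem_B E H J B hB hcα⟩ (by
      intro y
      apply Subtype.ext
      apply coef_ext E
      intro γ
      obtain ⟨β, rfl⟩ : ∃ β, γ = α + β := ⟨γ - α, by abel⟩
      have h1 := coef_mono_mul E y c β α
      have h2 := coef_mul_mono E y c β α
      rw [add_comm β α] at h2
      refine h1.trans (Eq.trans ?_ h2.symm)
      rw [hσ α hfα, AlgEquiv.one_apply]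
      linear_combination (coef E (y : A) β) * hcrel β)
    have h1 := congrArg (fun y : ↥B => coef E (y : A) α) hr
    simp only [hιB, coef_ι, coef_mono] at h1
    rw [Finsupp.single_eq_same, Finsupp.single_eq_of_ne hα] at h1
    exact hc0 h1
  refine ⟨f0, hf0, ?_⟩
  have : ιB f0 = f := by
    apply Subtype.ext
    rw [hιB]
    apply coef_ext E
    intro α
    rw [coef_ι]
    by_cases h : α = 0
    · subst h; simp [hf0def]
    · rw [hvan α h, Finsupp.single_eq_of_ne h]
  rw [this]
  exact hf

end simple

/-- Simplicity criterion.  Let `R` be a commutative noetherian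
domain and `B = R_p(t, σ, H, J)` a BR algebra of rank `n`, `Γ ≤ Aut R` the group
generated by `σ₁, …, σₙ`, and `X` the canonical Ore set.  Then `B` is a simple
ring if and only if: (1) `B x B = B` for every `x ∈ X`; (2) `R` is `Γ`-simple; and
(3) `Z(B) ⊆ R`. -/
theorem brAlgebra_simplicity_criterion
    {k R A : Type*} [Field k] [CommRing R] [IsDomain R] [IsNoetherianRing R]
    [Algebra k R] [Ring A] [Algebra k A]
    {n : ℕ} {σ : Fin n → R ≃ₐ[k] R} {p : Fin n → Fin n → kˣ}
    {H J : Fin n → Submodule k R} (hD : IsBRDatum σ p H J)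
    (E : SkewLaurent k σ p A) (B : Subalgebra k A)
    (hB : Subalgebra.toSubmodule B = brSubmodule E H J)
    (ιB : R →ₐ[k] ↥B) (hιB : ∀ r : R, ((ιB r : ↥B) : A) = E.ι r) :
    IsSimpleRing ↥B ↔
      ((∀ x ∈ oreSet E H J B,
        Submodule.span k {z : ↥B | ∃ a b : ↥B, z = a * x * b} = ⊤) ∧
      (∀ I : Ideal R, (∀ i, Ideal.map (σ i) I = I) → I = ⊥ ∨ I = ⊤) ∧
      (∀ z : ↥B, (∀ y : ↥B, z * y = y * z) → ∃ r : R, z = ιB r)) := by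
  constructor
  · intro hs
    refine ⟨?_, fun I hI => forward_gamma E B ιB hιB hs I hI,
      fun z hz => forward_center hD E B hB ιB hιB hs z hz⟩
    intro x hx
    have hl : ∀ a y : ↥B, y ∈ Submodule.span k {z : ↥B | ∃ a b : ↥B, z = a * x * b} →
        a * y ∈ Submodule.span k {z : ↥B | ∃ a b : ↥B, z = a * x * b} := by
      intro a y hy
      induction hy using Submodule.span_induction with
      | mem y hy =>
        obtain ⟨c, d, rfl⟩ := hy
        exact Submodule.subset_span ⟨a * c, d, by simp only [mul_assoc]⟩
      | zero => simp
      | add y z _ _ hy hz => rw [mul_add]; exact Submodule.add_mem _ hy hz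
      | smul c y _ hy => rw [mul_smul_comm]; exact Submodule.smul_mem _ _ hy
    have hr : ∀ a y : ↥B, y ∈ Submodule.span k {z : ↥B | ∃ a b : ↥B, z = a * x * b} →
        y * a ∈ Submodule.span k {z : ↥B | ∃ a b : ↥B, z = a * x * b} := by
      intro a y hy
      induction hy using Submodule.span_induction with
      | mem y hy =>
        obtain ⟨c, d, rfl⟩ := hy
        exact Submodule.subset_span ⟨c, d * a, by simp only [mul_assoc]⟩
      | zero => simp
      | add y z _ _ hy hz => rw [add_mul]; exact Submodule.add_mem _ hy hz
      | smul c y _ hy => rw [smul_mul_assoc]; exact Submodule.smul_mem _ _ hy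
    have h1 := one_mem_of_simple hs _ hl hr x
      (Submodule.subset_span ⟨1, 1, by simp⟩) hx.1
    rw [eq_top_iff]
    intro y _
    simpa using hl y 1 h1
  · rintro ⟨h1, h2, h3⟩
    have hιne : ∀ r : R, r ≠ 0 → ιB r ≠ 0 := by
      intro r hr0 h
      have h2 := congrArg (fun y : ↥B => coef E (y : A) 0) h
      simp only [hιB, coef_ι] at h2
      simp at h2
      exact hr0 h2
    have : Nontrivial ↥B := ⟨⟨1, 0, by rw [← map_one ιB]; exact hιne 1 one_ne_zero⟩⟩
    apply simple_of
    intro I x hx hx0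
    obtain ⟨r, hr0, hr⟩ := meets hD E B hB ιB hιB h2 h3 I x hx hx0
    by_cases hn : n = 0
    · subst hn
      rcases h2 (Ideal.span {r}) (fun i => i.elim0) with h | h
      · exact absurd (Ideal.span_singleton_eq_bot.1 h) hr0
      · obtain ⟨s, hs⟩ := Ideal.mem_span_singleton.1 ((Ideal.eq_top_iff_one _).1 h)
        have := I.mul_mem_right _ (ιB s) hr
        rwa [← map_mul, ← hs, map_one] at this
    · let i : Fin n := ⟨0, Nat.pos_of_ne_zero hn⟩
      obtain ⟨c, hc, hc0⟩ := segVec_ne hD (Pi.single i 1)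
      let y : ↥B := ιB r * ⟨_, mono_mem_B E H J B hB hc⟩
      have hy : y ∈ I := I.mul_mem_right _ _ hr
      have hyA : (y : A) = E.ι (r * c) * (tpow E.t (Pi.single i 1) : A) := by
        simp only [y, MulMemClass.coe_mul, hιB, map_mul, mul_assoc]
      have hco : coef E (y : A) (Pi.single i 1) = r * c := by
        rw [hyA, coef_mono, Finsupp.single_eq_same]
      have hyX : y ∈ oreSet E H J B := by
        refine ⟨?_, Or.inr ⟨Pi.single i 1, ?_, ?_, r * c, ?_, hyA⟩⟩
        · intro h
          rw [h] at hco
          simp only [ZeroMemClass.coe_zero, map_zero, Finsupp.coe_zero, Pi.zero_apply] at hco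
          exact mul_ne_zero hr0 hc0 hco.symm
        · intro j
          by_cases hj : j = i
          · subst hj; simp
          · simp [hj]
        · intro h
          have := congrFun h i
          simp at this
        · rw [← hco]
          exact (mem_B_iff E H J B hB y).1 y.2 _
      have hspan : (1 : ↥B) ∈ Submodule.span k {z : ↥B | ∃ a b : ↥B, z = a * y * b} := by
        rw [h1 y hyX]; trivial
      clear_value y
      generalize (1 : ↥B) = u at hspan
      induction hspan using Submodule.span_induction with
      | mem z hz =>
        obtain ⟨a, b, rfl⟩ := hz
        exact I.mul_mem_right _ _ (I.mul_mem_left _ _ hy)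
      | zero => exact I.zero_mem
      | add a b _ _ ha hb => exact I.add_mem ha hb
      | smul a b _ hb => rw [Algebra.smul_def]; exact I.mul_mem_left _ _ hb

end BR
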